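/- arXiv:1902.06260 — 2 statements merged into one kernel-verified Lean document; each statement's English description precedes it below -/
import Mathlib

section
/- Let A be a split regular BiHom-Poisson superalgebra with root system Λ. Then A = U + Σ_{[α]∈Λ/∼} I_{[α]}, where U is any linear complement in H of span_K{[A_{α∘ψ⁻¹}, A_{−α∘φ⁻¹}] + A_{α∘ψ⁻¹}·A_{−α∘φ⁻¹} : α ∈ Λ}, each I_{[α]} is an ideal of A, and [I_{[α]}, I_{[β]}] + I_{[α]}·I_{[β]} = 0 whenever [α] ≠ [β]. -/
/-- A (regular, with distinguished maximal abelian graded subalgebra `H`)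
BiHom-Poisson superalgebra over a field `K`. -/
structure BHPS (K A : Type*) [Field K] [AddCommGroup A] [Module K A] where
  /-- the ℤ₂-grading -/
  grade : ZMod 2 → Submodule K A
  gradeInternal : DirectSum.IsInternal grade
  /-- the bracket -/
  br : A →ₗ[K] A →ₗ[K] A
  /-- the associative-type product -/
  mu : A →ₗ[K] A →ₗ[K] A
  /-- the first structure map -/
  phi : A ≃ₗ[K] A
  /-- the second structure map -/
  psi : A ≃ₗ[K] A
  br_grade : ∀ (i j : ZMod 2), ∀ x ∈ grade i, ∀ y ∈ grade j, br x y ∈ grade (i + j)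
  mu_grade : ∀ (i j : ZMod 2), ∀ x ∈ grade i, ∀ y ∈ grade j, mu x y ∈ grade (i + j)
  phi_grade : ∀ i, (grade i).map (phi : A →ₗ[K] A) = grade i
  psi_grade : ∀ i, (grade i).map (psi : A →ₗ[K] A) = grade i
  phi_psi_comm : ∀ x, phi (psi x) = psi (phi x)
  phi_br : ∀ x y, phi (br x y) = br (phi x) (phi y)
  psi_br : ∀ x y, psi (br x y) = br (psi x) (psi y)
  phi_mu : ∀ x y, phi (mu x y) = mu (phi x) (phi y)
  psi_mu : ∀ x y, psi (mu x y) = mu (psi x) (psi y)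
  skew : ∀ (i j : ZMod 2), ∀ x ∈ grade i, ∀ y ∈ grade j,
    br (psi x) (phi y) = -((-1 : K) ^ (i.val * j.val)) • br (psi y) (phi x)
  jacobi : ∀ (i j k : ZMod 2), ∀ x ∈ grade i, ∀ y ∈ grade j, ∀ z ∈ grade k,
    ((-1 : K) ^ (i.val * k.val)) • br (psi (psi x)) (br (psi y) (phi z))
      + ((-1 : K) ^ (i.val * j.val)) • br (psi (psi y)) (br (psi z) (phi x))
      + ((-1 : K) ^ (j.val * k.val)) • br (psi (psi z)) (br (psi x) (phi y)) = 0
  assoc : ∀ x y z, mu (phi x) (mu y z) = mu (mu x y) (psi z)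
  leibniz : ∀ (j k : ZMod 2), ∀ (x : A), ∀ y ∈ grade j, ∀ z ∈ grade k,
    br (mu x y) (phi (psi z))
      = mu (phi x) (br y (phi z)) + ((-1 : K) ^ (j.val * k.val)) • mu (br x (psi z)) (phi y)
  /-- the maximal abelian graded subalgebra -/
  H : Submodule K A
  H_graded : H = (H ⊓ grade 0) ⊔ (H ⊓ grade 1)
  H_abelian : ∀ x ∈ H, ∀ y ∈ H, br x y = 0
  phi_H : H.map (phi : A →ₗ[K] A) = H
  psi_H : H.map (psi : A →ₗ[K] A) = H
  H_max : ∀ H' : Submodule K A, H ≤ H' →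
    H' = (H' ⊓ grade 0) ⊔ (H' ⊓ grade 1) →
    (∀ x ∈ H', ∀ y ∈ H', br x y = 0) →
    H'.map (phi : A →ₗ[K] A) = H' → H'.map (psi : A →ₗ[K] A) = H' → H' = H

namespace BHPS

variable {K A : Type*} [Field K] [AddCommGroup A] [Module K A] (D : BHPS K A)

/-- The even part `H₀` of `H`. -/
def H0 : Submodule K A := D.H ⊓ D.grade 0

lemma phi_H0 : D.H0.map (D.phi : A →ₗ[K] A) = D.H0 := by
  unfold H0
  rw [Submodule.map_inf (D.phi : A →ₗ[K] A) D.phi.injective, D.phi_H, D.phi_grade]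

lemma psi_H0 : D.H0.map (D.psi : A →ₗ[K] A) = D.H0 := by
  unfold H0
  rw [Submodule.map_inf (D.psi : A →ₗ[K] A) D.psi.injective, D.psi_H, D.psi_grade]

/-- The restriction of `φ` to `H₀`, as a linear automorphism. -/
def phiH0 : ↥D.H0 ≃ₗ[K] ↥D.H0 :=
  (D.phi.submoduleMap D.H0).trans (LinearEquiv.ofEq _ _ D.phi_H0)

/-- The restriction of `ψ` to `H₀`, as a linear automorphism. -/
def psiH0 : ↥D.H0 ≃ₗ[K] ↥D.H0 :=
  (D.psi.submoduleMap D.H0).trans (LinearEquiv.ofEq _ _ D.psi_H0)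

/-- The root space attached to a linear functional `α : H₀ → K`:
`A_α = {v : [h, φ(v)] = α(h) • φψ(v) for all h ∈ H₀}`. -/
def rootSpace (α : Module.Dual K ↥D.H0) : Submodule K A where
  carrier := {v | ∀ h : ↥D.H0, D.br (h : A) (D.phi v) = α h • D.phi (D.psi v)}
  add_mem' := by
    intro a b ha hb h
    simp only [map_add, ha h, hb h, smul_add]
  zero_mem' := by
    intro h
    simp
  smul_mem' := by
    intro c v hv h
    simp only [map_smul, hv h]
    rw [smul_comm]

/-- The root system `Λ`. -/
def roots : Set (Module.Dual K ↥D.H0) := {α | α ≠ 0 ∧ D.rootSpace α ≠ ⊥}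

/-- `A` is split with respect to `H`: `A = H ⊕ (⊕_{α ∈ Λ} A_α)`. -/
def IsSplit : Prop :=
  letI := Classical.decEq (Option ↥D.roots)
  DirectSum.IsInternal (fun o : Option ↥D.roots => o.elim D.H fun α => D.rootSpace α.1)

/-- `α ∘ φ^{z₁} ∘ ψ^{z₂}`. -/
def twist (z₁ z₂ : ℤ) (γ : Module.Dual K ↥D.H0) : Module.Dual K ↥D.H0 :=
  γ ∘ₗ ((((D.phiH0 ^ z₁) : ↥D.H0 ≃ₗ[K] ↥D.H0) : ↥D.H0 →ₗ[K] ↥D.H0) ∘ₗ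
        (((D.psiH0 ^ z₂) : ↥D.H0 ≃ₗ[K] ↥D.H0) : ↥D.H0 →ₗ[K] ↥D.H0))

/-- `±S = S ∪ (-S)`. -/
def pm (S : Set (Module.Dual K ↥D.H0)) : Set (Module.Dual K ↥D.H0) :=
  S ∪ (Neg.neg '' S)

/-- The partial sums `α₁∘φ^{-i} + α₂∘φ^{-i+1}∘ψ^{-1} + ⋯ + α_i∘φ^{-1}∘ψ^{-1} + α_{i+1}∘ψ^{-1}`
appearing in the definition of a connection. -/
def chainSum (a : ℕ → Module.Dual K ↥D.H0) (i : ℕ) : Module.Dual K ↥D.H0 :=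
  D.twist (-(i : ℤ)) 0 (a 1)
    + ∑ t ∈ Finset.Icc 2 (i + 1), D.twist (-((i : ℤ) + 1 - (t : ℤ))) (-1) (a t)

/-- `a 1, …, a k` is a connection from `α` to `β` (relative to the set of roots `S`). -/
def IsConnectionIn (S : Set (Module.Dual K ↥D.H0)) (α β : Module.Dual K ↥D.H0)
    (k : ℕ) (a : ℕ → Module.Dual K ↥D.H0) : Prop :=
  2 ≤ k ∧
  (∀ t, 1 ≤ t → t ≤ k → a t ∈ D.pm S) ∧
  (∃ n r : ℕ, a 1 = D.twist (-(n : ℤ)) (-(r : ℤ)) α) ∧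
  (∀ i, 1 ≤ i → i ≤ k - 2 → D.chainSum a i ∈ D.pm S) ∧
  (∃ m s : ℕ, D.chainSum a (k - 1) = D.twist (-(m : ℤ)) (-(s : ℤ)) β
      ∨ D.chainSum a (k - 1) = -(D.twist (-(m : ℤ)) (-(s : ℤ)) β))

/-- `α` is connected to `β` (relative to the set of roots `S`). -/
def ConnectedIn (S : Set (Module.Dual K ↥D.H0)) (α β : Module.Dual K ↥D.H0) : Prop :=
  (∃ z₁ z₂ : ℤ, ∃ ε : K, (ε = 1 ∨ ε = -1) ∧ β = ε • D.twist z₁ z₂ α) ∨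
  (∃ k a, D.IsConnectionIn S α β k a)

/-- `α` is connected to `β`. -/
def Connected (α β : Module.Dual K ↥D.H0) : Prop := D.ConnectedIn D.roots α β

/-- The set `[α]` of roots connected to `α`. -/
def classSet (α : Module.Dual K ↥D.H0) : Set (Module.Dual K ↥D.H0) :=
  {β ∈ D.roots | D.Connected α β}

/-- `I_{H,[α]} = span {[A_{β∘ψ⁻¹}, A_{−β∘φ⁻¹}] + A_{β∘ψ⁻¹}·A_{−β∘φ⁻¹} : β ∈ [α]}`. -/
def IH (α : Module.Dual K ↥D.H0) : Submodule K A :=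
  ⨆ β ∈ D.classSet α,
    (Submodule.map₂ D.br (D.rootSpace (D.twist 0 (-1) β)) (D.rootSpace (-(D.twist (-1) 0 β)))
      ⊔ Submodule.map₂ D.mu (D.rootSpace (D.twist 0 (-1) β)) (D.rootSpace (-(D.twist (-1) 0 β))))

/-- `V_{[α]} = ⊕_{β ∈ [α]} A_β`. -/
def VS (α : Module.Dual K ↥D.H0) : Submodule K A :=
  ⨆ β ∈ D.classSet α, D.rootSpace β

/-- `I_{[α]} = I_{H,[α]} ⊕ V_{[α]}`. -/
def Iclass (α : Module.Dual K ↥D.H0) : Submodule K A := D.IH α ⊔ D.VS α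

/-- `J` is an ideal of the (sub)algebra `I`. -/
def IsIdealIn (J I : Submodule K A) : Prop :=
  J ≤ I ∧ J = (J ⊓ D.grade 0) ⊔ (J ⊓ D.grade 1) ∧
  Submodule.map₂ D.br J I ≤ J ∧ Submodule.map₂ D.mu J I ≤ J ∧ Submodule.map₂ D.mu I J ≤ J ∧
  J.map (D.phi : A →ₗ[K] A) = J ∧ J.map (D.psi : A →ₗ[K] A) = J

/-- `I` is an ideal of `A`: `[I,A] + I·A + A·I ⊆ I`, graded and `φ,ψ`-invariant. -/
def IsIdeal (I : Submodule K A) : Prop := D.IsIdealIn I ⊤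

/-- `A` is simple: `[A,A] + A·A ≠ 0` and its only ideals are `0` and `A`. -/
def IsSimple : Prop :=
  (Submodule.map₂ D.br ⊤ ⊤ ⊔ Submodule.map₂ D.mu (⊤ : Submodule K A) ⊤ ≠ ⊥) ∧
  ∀ I : Submodule K A, D.IsIdeal I → I = ⊥ ∨ I = ⊤

/-- The center `Z(A) = {v : [v,A] + v·A + A·v = 0}`. -/
def center : Submodule K A where
  carrier := {v | ∀ w, D.br v w = 0 ∧ D.mu v w = 0 ∧ D.mu w v = 0}
  add_mem' := by
    intro a b ha hb w
    obtain ⟨h1, h2, h3⟩ := ha w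
    obtain ⟨g1, g2, g3⟩ := hb w
    simp [map_add, LinearMap.add_apply, h1, h2, h3, g1, g2, g3]
  zero_mem' := by intro w; simp
  smul_mem' := by
    intro c v hv w
    obtain ⟨h1, h2, h3⟩ := hv w
    simp [map_smul, LinearMap.smul_apply, h1, h2, h3]

/-- `Σ_{α∈Λ} ([A_{α∘ψ⁻¹}, A_{−α∘φ⁻¹}] + A_{α∘ψ⁻¹}·A_{−α∘φ⁻¹})`. -/
def HSum : Submodule K A :=
  ⨆ α ∈ D.roots,
    (Submodule.map₂ D.br (D.rootSpace (D.twist 0 (-1) α)) (D.rootSpace (-(D.twist (-1) 0 α)))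
      ⊔ Submodule.map₂ D.mu (D.rootSpace (D.twist 0 (-1) α)) (D.rootSpace (-(D.twist (-1) 0 α))))

/-- The root system is symmetric. -/
def IsSymmetric : Prop := ∀ α ∈ D.roots, -α ∈ D.roots

/-- `A` is root multiplicative. -/
def RootMultiplicative : Prop :=
  ∀ (i j : ZMod 2) (α β : Module.Dual K ↥D.H0), α ∈ D.roots → β ∈ D.roots →
    D.rootSpace α ⊓ D.grade i ≠ ⊥ → D.rootSpace β ⊓ D.grade j ≠ ⊥ →
    (D.twist 0 (-1) α + D.twist (-1) 0 β) ∈ D.roots →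
    D.rootSpace (D.twist 0 (-1) α + D.twist (-1) 0 β) ⊓ D.grade (i + j) ≠ ⊥ →
    Submodule.map₂ D.br (D.rootSpace α ⊓ D.grade i) (D.rootSpace β ⊓ D.grade j)
      ⊔ Submodule.map₂ D.mu (D.rootSpace α ⊓ D.grade i) (D.rootSpace β ⊓ D.grade j) ≠ ⊥

/-- `A` is of maximal length: every nonzero graded root space is one-dimensional. -/
def MaximalLength : Prop :=
  ∀ (i : ZMod 2), ∀ α ∈ D.roots, D.rootSpace α ⊓ D.grade i ≠ ⊥ →
    Module.rank K ↥(D.rootSpace α ⊓ D.grade i) = 1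

end BHPS

namespace BHPS

variable {K A : Type*} [Field K] [AddCommGroup A] [Module K A] (D : BHPS K A)

/-! ### Twists of functionals -/

lemma commute_phiH0_psiH0 : Commute D.phiH0 D.psiH0 := by
  refine LinearEquiv.ext fun h => Subtype.ext ?_
  exact D.phi_psi_comm h

lemma twist_apply (a b : ℤ) (γ : Module.Dual K ↥D.H0) (h : ↥D.H0) :
    D.twist a b γ h = γ ((D.phiH0 ^ a * D.psiH0 ^ b) h) := rfl

@[simp]
lemma twist_twist (a b c d : ℤ) (γ : Module.Dual K ↥D.H0) :
    D.twist a b (D.twist c d γ) = D.twist (c + a) (d + b) γ := by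
  ext h
  simp only [twist_apply]
  rw [← LinearEquiv.mul_apply, zpow_add, zpow_add]
  congr 2
  have := (D.commute_phiH0_psiH0.zpow_zpow a d).eq
  simp only [mul_assoc]
  rw [← mul_assoc (D.psiH0 ^ d), ← this, mul_assoc]

@[simp]
lemma twist_zero_zero (γ : Module.Dual K ↥D.H0) : D.twist 0 0 γ = γ := by
  ext h
  simp [twist_apply]

@[simp]
lemma twist_add (a b : ℤ) (γ δ : Module.Dual K ↥D.H0) :
    D.twist a b (γ + δ) = D.twist a b γ + D.twist a b δ := rfl

@[simp]
lemma twist_neg (a b : ℤ) (γ : Module.Dual K ↥D.H0) :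
    D.twist a b (-γ) = -D.twist a b γ := rfl

@[simp]
lemma twist_zero (a b : ℤ) : D.twist a b 0 = 0 := rfl

lemma twist_phiH0 (γ : Module.Dual K ↥D.H0) (h : ↥D.H0) :
    D.twist (-1) 0 γ (D.phiH0 h) = γ h := by
  rw [twist_apply, ← LinearEquiv.mul_apply]
  simp

lemma twist_psiH0 (γ : Module.Dual K ↥D.H0) (h : ↥D.H0) :
    D.twist 0 (-1) γ (D.psiH0 h) = γ h := by
  rw [twist_apply, ← LinearEquiv.mul_apply]
  simp

lemma eq_twist_neg_iff {a b : ℤ} {γ δ : Module.Dual K ↥D.H0} :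
    γ = D.twist a b δ ↔ D.twist (-a) (-b) γ = δ := by
  constructor
  · rintro rfl
    simp
  · rintro rfl
    simp

/-! ### The structure maps, the grading and root spaces -/

lemma phi_symm_br (x y : A) : D.phi.symm (D.br x y) = D.br (D.phi.symm x) (D.phi.symm y) := by
  rw [LinearEquiv.symm_apply_eq, D.phi_br]
  simp

lemma psi_symm_br (x y : A) : D.psi.symm (D.br x y) = D.br (D.psi.symm x) (D.psi.symm y) := by
  rw [LinearEquiv.symm_apply_eq, D.psi_br]
  simp

lemma phi_symm_mu (x y : A) : D.phi.symm (D.mu x y) = D.mu (D.phi.symm x) (D.phi.symm y) := by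
  rw [LinearEquiv.symm_apply_eq, D.phi_mu]
  simp

lemma psi_symm_mu (x y : A) : D.psi.symm (D.mu x y) = D.mu (D.psi.symm x) (D.psi.symm y) := by
  rw [LinearEquiv.symm_apply_eq, D.psi_mu]
  simp

lemma phi_symm_grade {i : ZMod 2} {x : A} (hx : x ∈ D.grade i) : D.phi.symm x ∈ D.grade i := by
  rw [← D.phi_grade i] at hx
  obtain ⟨y, hy, rfl⟩ := hx
  simpa using hy

lemma psi_symm_grade {i : ZMod 2} {x : A} (hx : x ∈ D.grade i) : D.psi.symm x ∈ D.grade i := by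
  rw [← D.psi_grade i] at hx
  obtain ⟨y, hy, rfl⟩ := hx
  simpa using hy

lemma phi_mem_grade {i : ZMod 2} {x : A} (hx : x ∈ D.grade i) : D.phi x ∈ D.grade i := by
  rw [← D.phi_grade i]
  exact ⟨x, hx, rfl⟩

lemma psi_mem_grade {i : ZMod 2} {x : A} (hx : x ∈ D.grade i) : D.psi x ∈ D.grade i := by
  rw [← D.psi_grade i]
  exact ⟨x, hx, rfl⟩

lemma zmod_two_cases (i : ZMod 2) : i = 0 ∨ i = 1 := by
  revert i
  decide

lemma grade_sup : D.grade 0 ⊔ D.grade 1 = ⊤ := by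
  rw [eq_top_iff, ← D.gradeInternal.submodule_iSup_eq_top]
  refine iSup_le fun i => ?_
  rcases zmod_two_cases i with rfl | rfl
  · exact le_sup_left
  · exact le_sup_right

lemma grade_disjoint : Disjoint (D.grade 0) (D.grade 1) :=
  D.gradeInternal.submodule_iSupIndep.pairwiseDisjoint (by decide)

lemma mem_rootSpace {α : Module.Dual K ↥D.H0} {v : A} :
    v ∈ D.rootSpace α ↔ ∀ h : ↥D.H0, D.br (h : A) (D.phi v) = α h • D.phi (D.psi v) := Iff.rfl

lemma phi_mem_rootSpace {γ : Module.Dual K ↥D.H0} {v : A} :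
    D.phi v ∈ D.rootSpace (D.twist (-1) 0 γ) ↔ v ∈ D.rootSpace γ := by
  rw [mem_rootSpace, mem_rootSpace, D.phiH0.surjective.forall]
  refine forall_congr' fun h => ?_
  rw [twist_phiH0]
  change D.br (D.phi h) _ = _ ↔ _
  rw [← D.phi_br, ← D.phi_psi_comm, ← map_smul, D.phi.injective.eq_iff]

lemma psi_mem_rootSpace {γ : Module.Dual K ↥D.H0} {v : A} :
    D.psi v ∈ D.rootSpace (D.twist 0 (-1) γ) ↔ v ∈ D.rootSpace γ := by
  rw [mem_rootSpace, mem_rootSpace, D.psiH0.surjective.forall]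
  refine forall_congr' fun h => ?_
  rw [twist_psiH0]
  change D.br (D.psi h) _ = _ ↔ _
  rw [D.phi_psi_comm, ← D.psi_br, D.phi_psi_comm, ← map_smul, D.psi.injective.eq_iff,
    D.phi_psi_comm]

lemma phi_symm_mem_rootSpace {γ : Module.Dual K ↥D.H0} {v : A} (hv : v ∈ D.rootSpace γ) :
    D.phi.symm v ∈ D.rootSpace (D.twist 1 0 γ) := by
  rw [← phi_mem_rootSpace]
  simpa using hv

lemma psi_symm_mem_rootSpace {γ : Module.Dual K ↥D.H0} {v : A} (hv : v ∈ D.rootSpace γ) :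
    D.psi.symm v ∈ D.rootSpace (D.twist 0 1 γ) := by
  rw [← psi_mem_rootSpace]
  simpa using hv

/-! ### Graded subspaces stable under the structure maps -/

/-- A graded subspace with `φ(P) = ψ(P) = P`. -/
structure IsStable (P : Submodule K A) : Prop where
  graded : P ≤ (P ⊓ D.grade 0) ⊔ (P ⊓ D.grade 1)
  phi_mem : ∀ x ∈ P, D.phi x ∈ P
  psi_mem : ∀ x ∈ P, D.psi x ∈ P
  phi_symm_mem : ∀ x ∈ P, D.phi.symm x ∈ P
  psi_symm_mem : ∀ x ∈ P, D.psi.symm x ∈ P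

variable {D}

lemma le_of_homogeneous {P N : Submodule K A} (hP : P ≤ (P ⊓ D.grade 0) ⊔ (P ⊓ D.grade 1))
    (h : ∀ i, ∀ x ∈ P, x ∈ D.grade i → x ∈ N) : P ≤ N :=
  hP.trans (sup_le (fun x hx => h 0 x hx.1 hx.2) (fun x hx => h 1 x hx.1 hx.2))

lemma mem_graded_of_homogeneous {P : Submodule K A} {i : ZMod 2} {x : A} (hx : x ∈ P)
    (hi : x ∈ D.grade i) : x ∈ (P ⊓ D.grade 0) ⊔ (P ⊓ D.grade 1) := by
  rcases zmod_two_cases i with rfl | rfl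
  · exact Submodule.mem_sup_left ⟨hx, hi⟩
  · exact Submodule.mem_sup_right ⟨hx, hi⟩

lemma IsStable.sup {P Q : Submodule K A} (hP : D.IsStable P) (hQ : D.IsStable Q) :
    D.IsStable (P ⊔ Q) where
  graded := sup_le
    (le_of_homogeneous hP.graded fun _ _ hx hi =>
      mem_graded_of_homogeneous (Submodule.mem_sup_left hx) hi)
    (le_of_homogeneous hQ.graded fun _ _ hx hi =>
      mem_graded_of_homogeneous (Submodule.mem_sup_right hx) hi)
  phi_mem := by
    change P ⊔ Q ≤ (P ⊔ Q).comap (D.phi : A →ₗ[K] A)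
    exact sup_le (fun x hx => Submodule.mem_sup_left (hP.phi_mem x hx))
      (fun x hx => Submodule.mem_sup_right (hQ.phi_mem x hx))
  psi_mem := by
    change P ⊔ Q ≤ (P ⊔ Q).comap (D.psi : A →ₗ[K] A)
    exact sup_le (fun x hx => Submodule.mem_sup_left (hP.psi_mem x hx))
      (fun x hx => Submodule.mem_sup_right (hQ.psi_mem x hx))
  phi_symm_mem := by
    change P ⊔ Q ≤ (P ⊔ Q).comap (D.phi.symm : A →ₗ[K] A)
    exact sup_le (fun x hx => Submodule.mem_sup_left (hP.phi_symm_mem x hx))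
      (fun x hx => Submodule.mem_sup_right (hQ.phi_symm_mem x hx))
  psi_symm_mem := by
    change P ⊔ Q ≤ (P ⊔ Q).comap (D.psi.symm : A →ₗ[K] A)
    exact sup_le (fun x hx => Submodule.mem_sup_left (hP.psi_symm_mem x hx))
      (fun x hx => Submodule.mem_sup_right (hQ.psi_symm_mem x hx))

lemma IsStable.map_phi {P : Submodule K A} (hP : D.IsStable P) :
    P.map (D.phi : A →ₗ[K] A) = P :=
  le_antisymm (Submodule.map_le_iff_le_comap.2 hP.phi_mem)
    (fun x hx => ⟨D.phi.symm x, hP.phi_symm_mem x hx, by simp⟩)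

lemma IsStable.map_psi {P : Submodule K A} (hP : D.IsStable P) :
    P.map (D.psi : A →ₗ[K] A) = P :=
  le_antisymm (Submodule.map_le_iff_le_comap.2 hP.psi_mem)
    (fun x hx => ⟨D.psi.symm x, hP.psi_symm_mem x hx, by simp⟩)

lemma IsStable.graded_eq {P : Submodule K A} (hP : D.IsStable P) :
    P = (P ⊓ D.grade 0) ⊔ (P ⊓ D.grade 1) :=
  le_antisymm hP.graded (sup_le inf_le_left inf_le_left)

variable (D)

lemma isStable_H : D.IsStable D.H where
  graded := D.H_graded.le
  phi_mem x hx := by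
    rw [← D.phi_H]
    exact ⟨x, hx, rfl⟩
  psi_mem x hx := by
    rw [← D.psi_H]
    exact ⟨x, hx, rfl⟩
  phi_symm_mem x hx := by
    rw [← D.phi_H] at hx
    obtain ⟨y, hy, rfl⟩ := hx
    simpa using hy
  psi_symm_mem x hx := by
    rw [← D.psi_H] at hx
    obtain ⟨y, hy, rfl⟩ := hx
    simpa using hy

/-- `[P, P] + P·P`. -/
def sq (P : Submodule K A) : Submodule K A := Submodule.map₂ D.br P P ⊔ Submodule.map₂ D.mu P P

variable {D}

lemma br_mem_sq {P : Submodule K A} {x y : A} (hx : x ∈ P) (hy : y ∈ P) : D.br x y ∈ D.sq P :=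
  Submodule.mem_sup_left (Submodule.apply_mem_map₂ _ hx hy)

lemma mu_mem_sq {P : Submodule K A} {x y : A} (hx : x ∈ P) (hy : y ∈ P) : D.mu x y ∈ D.sq P :=
  Submodule.mem_sup_right (Submodule.apply_mem_map₂ _ hx hy)

lemma sq_le {P N : Submodule K A} (hbr : ∀ x ∈ P, ∀ y ∈ P, D.br x y ∈ N)
    (hmu : ∀ x ∈ P, ∀ y ∈ P, D.mu x y ∈ N) : D.sq P ≤ N :=
  sup_le (Submodule.map₂_le.2 hbr) (Submodule.map₂_le.2 hmu)

/-- A bilinear map sends two graded subspaces into a given subspace as soon as it does so on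
homogeneous elements. -/
lemma bilin_mem_of_homogeneous (f : A →ₗ[K] A →ₗ[K] A) {P Q N : Submodule K A}
    (hP : P ≤ (P ⊓ D.grade 0) ⊔ (P ⊓ D.grade 1)) (hQ : Q ≤ (Q ⊓ D.grade 0) ⊔ (Q ⊓ D.grade 1))
    (h : ∀ i j, ∀ x ∈ P, x ∈ D.grade i → ∀ y ∈ Q, y ∈ D.grade j → f x y ∈ N) :
    ∀ x ∈ P, ∀ y ∈ Q, f x y ∈ N := by
  intro x hx y hy
  refine le_of_homogeneous (N := N.comap (f.flip y)) hP (fun i x hx hi => ?_) hx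
  exact le_of_homogeneous (N := N.comap (f x)) hQ (fun j y hy hj => h i j x hx hi y hy hj) hy

lemma IsStable.sq {P : Submodule K A} (hP : D.IsStable P) : D.IsStable (D.sq P) where
  graded := sq_le
    (bilin_mem_of_homogeneous _ hP.graded hP.graded fun i j x hx hi y hy hj =>
      mem_graded_of_homogeneous (br_mem_sq hx hy) (D.br_grade i j x hi y hj))
    (bilin_mem_of_homogeneous _ hP.graded hP.graded fun i j x hx hi y hy hj =>
      mem_graded_of_homogeneous (mu_mem_sq hx hy) (D.mu_grade i j x hi y hj))
  phi_mem := by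
    change D.sq P ≤ (D.sq P).comap (D.phi : A →ₗ[K] A)
    refine sq_le (fun x hx y hy => ?_) (fun x hx y hy => ?_)
    · simpa [D.phi_br] using br_mem_sq (hP.phi_mem x hx) (hP.phi_mem y hy)
    · simpa [D.phi_mu] using mu_mem_sq (hP.phi_mem x hx) (hP.phi_mem y hy)
  psi_mem := by
    change D.sq P ≤ (D.sq P).comap (D.psi : A →ₗ[K] A)
    refine sq_le (fun x hx y hy => ?_) (fun x hx y hy => ?_)
    · simpa [D.psi_br] using br_mem_sq (hP.psi_mem x hx) (hP.psi_mem y hy)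
    · simpa [D.psi_mu] using mu_mem_sq (hP.psi_mem x hx) (hP.psi_mem y hy)
  phi_symm_mem := by
    change D.sq P ≤ (D.sq P).comap (D.phi.symm : A →ₗ[K] A)
    refine sq_le (fun x hx y hy => ?_) (fun x hx y hy => ?_)
    · simpa [D.phi_symm_br] using br_mem_sq (hP.phi_symm_mem x hx) (hP.phi_symm_mem y hy)
    · simpa [D.phi_symm_mu] using mu_mem_sq (hP.phi_symm_mem x hx) (hP.phi_symm_mem y hy)
  psi_symm_mem := by
    change D.sq P ≤ (D.sq P).comap (D.psi.symm : A →ₗ[K] A)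
    refine sq_le (fun x hx y hy => ?_) (fun x hx y hy => ?_)
    · simpa [D.psi_symm_br] using br_mem_sq (hP.psi_symm_mem x hx) (hP.psi_symm_mem y hy)
    · simpa [D.psi_symm_mu] using mu_mem_sq (hP.psi_symm_mem x hx) (hP.psi_symm_mem y hy)

/-! ### Subspaces all of whose mutual products lie in a given subspace -/

variable (D)

/-- The elements `y` with `[x, y], [y, x], xy, yx ∈ T`. -/
def transporter (T : Submodule K A) (x : A) : Submodule K A :=
  (T.comap (D.br x) ⊓ T.comap (D.br.flip x)) ⊓ (T.comap (D.mu x) ⊓ T.comap (D.mu.flip x))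

/-- `[P, X] + [X, P] + P·X + X·P ⊆ T`. -/
def ProductsIn (P X T : Submodule K A) : Prop := ∀ p ∈ P, X ≤ D.transporter T p

variable {D}

lemma mem_transporter {T : Submodule K A} {x y : A} : y ∈ D.transporter T x ↔
    (D.br x y ∈ T ∧ D.br y x ∈ T) ∧ (D.mu x y ∈ T ∧ D.mu y x ∈ T) := Iff.rfl

lemma mem_transporter_comm {T : Submodule K A} {x y : A} :
    y ∈ D.transporter T x ↔ x ∈ D.transporter T y := by
  simp only [mem_transporter]
  tauto

lemma ProductsIn.symm {P X T : Submodule K A} (h : D.ProductsIn P X T) : D.ProductsIn X P T :=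
  fun _ hx p hp => mem_transporter_comm.1 (h p hp hx)

lemma ProductsIn.mono {P X T P' X' T' : Submodule K A} (h : D.ProductsIn P X T) (hP : P' ≤ P)
    (hX : X' ≤ X) (hT : T ≤ T') : D.ProductsIn P' X' T' := by
  intro p hp x hx
  obtain ⟨⟨h1, h2⟩, h3, h4⟩ := h p (hP hp) (hX hx)
  exact ⟨⟨hT h1, hT h2⟩, hT h3, hT h4⟩

lemma ProductsIn.sup_right {P X Y T : Submodule K A} (hX : D.ProductsIn P X T)
    (hY : D.ProductsIn P Y T) : D.ProductsIn P (X ⊔ Y) T :=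
  fun p hp => sup_le (hX p hp) (hY p hp)

lemma ProductsIn.sup_left {P Q X T : Submodule K A} (hP : D.ProductsIn P X T)
    (hQ : D.ProductsIn Q X T) : D.ProductsIn (P ⊔ Q) X T :=
  (hP.symm.sup_right hQ.symm).symm

lemma productsIn_iSup₂_right {ι : Type*} {s : Set ι} {P T : Submodule K A} {X : ι → Submodule K A}
    (h : ∀ i ∈ s, D.ProductsIn P (X i) T) : D.ProductsIn P (⨆ i ∈ s, X i) T :=
  fun p hp => iSup₂_le fun i hi => h i hi p hp

lemma productsIn_bot (P : Submodule K A) : D.ProductsIn P ⊥ ⊥ :=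
  fun _ _ => bot_le

lemma productsIn_sq (P : Submodule K A) : D.ProductsIn P P (D.sq P) :=
  fun _ hx _ hy => ⟨⟨br_mem_sq hx hy, br_mem_sq hy hx⟩, mu_mem_sq hx hy, mu_mem_sq hy hx⟩

variable (D) in
lemma br_comm_mem {S : Submodule K A} {i j : ZMod 2} {u v : A} (hu : u ∈ D.grade i)
    (hv : v ∈ D.grade j) (h : D.br (D.psi v) (D.phi u) ∈ S) : D.br (D.psi u) (D.phi v) ∈ S := by
  rw [D.skew i j u hu v hv]
  exact S.smul_mem _ h

lemma neg_one_pow_smul_mem_iff {S : Submodule K A} {n : ℕ} {v : A} :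
    ((-1 : K) ^ n) • v ∈ S ↔ v ∈ S :=
  S.smul_mem_iff (pow_ne_zero n (neg_ne_zero.2 one_ne_zero))

section Homogeneous

variable {P X T S : Submodule K A} (hP : D.IsStable P) (hX : D.IsStable X)
  (hPX : D.ProductsIn P X T) (hPT : D.ProductsIn P T S)
  {i j k : ZMod 2} {p q x : A} (hp : p ∈ P) (hq : q ∈ P) (hx : x ∈ X)
  (hpi : p ∈ D.grade i) (hqj : q ∈ D.grade j) (hxk : x ∈ D.grade k)

include hP hX hPX hPT hp hq hx

lemma mu_mu_mem : D.mu (D.mu p q) x ∈ S := by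
  have h := D.assoc p q (D.psi.symm x)
  rw [LinearEquiv.apply_symm_apply] at h
  rw [← h]
  exact (hPT _ (hP.phi_mem p hp) (hPX q hq (hX.psi_symm_mem x hx)).2.1).2.1

lemma mu_mu_mem' : D.mu x (D.mu p q) ∈ S := by
  have h := D.assoc (D.phi.symm x) p q
  rw [LinearEquiv.apply_symm_apply] at h
  rw [h]
  exact (hPT _ (hP.psi_mem q hq) (hPX p hp (hX.phi_symm_mem x hx)).2.2).2.2

include hqj hxk in
lemma br_mu_mem : D.br (D.mu p q) x ∈ S := by
  have hx' := hX.psi_symm_mem _ (hX.phi_symm_mem x hx)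
  have h := D.leibniz j k p q hqj _ (D.psi_symm_grade (D.phi_symm_grade hxk))
  rw [LinearEquiv.apply_symm_apply, LinearEquiv.apply_symm_apply] at h
  rw [h]
  refine S.add_mem ?_ (S.smul_mem _ ?_)
  · exact (hPT _ (hP.phi_mem p hp) (hPX q hq (hX.phi_mem _ hx')).1.1).2.1
  · exact (hPT _ (hP.phi_mem q hq) (hPX p hp (hX.phi_symm_mem x hx)).1.1).2.2

include hqj hxk in
lemma mu_br_mem : D.mu (D.br p q) x ∈ S := by
  have hx' := hX.phi_symm_mem x hx
  have hq' := hP.psi_symm_mem q hq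
  have h := D.leibniz k j p _ (D.phi_symm_grade hxk) _ (D.psi_symm_grade hqj)
  rw [LinearEquiv.apply_symm_apply, LinearEquiv.apply_symm_apply] at h
  rw [← neg_one_pow_smul_mem_iff (K := K), eq_sub_of_add_eq' h.symm]
  refine S.sub_mem ?_ ?_
  · exact (hPT _ (hP.phi_mem q hq) (hPX p hp hx').2.1).1.2
  · exact (hPT _ (hP.phi_mem p hp) (hPX _ (hP.phi_mem _ hq') hx').1.2).2.1

include hpi hqj in
lemma mu_br_mem' : D.mu x (D.br p q) ∈ S := by
  have hx' := hX.phi_symm_mem x hx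
  have hq' := hP.phi_symm_mem q hq
  have h := D.leibniz i j (D.phi.symm x) p hpi _ (D.phi_symm_grade hqj)
  rw [LinearEquiv.apply_symm_apply, LinearEquiv.apply_symm_apply, D.phi_psi_comm,
    LinearEquiv.apply_symm_apply] at h
  rw [eq_sub_of_add_eq h.symm]
  refine S.sub_mem ?_ (S.smul_mem _ ?_)
  · exact (hPT _ (hP.psi_mem q hq) (hPX p hp hx').2.2).1.2
  · exact (hPT _ (hP.phi_mem p hp) (hPX _ (hP.psi_mem _ hq') hx').1.2).2.2

include hpi hqj hxk in
lemma br_br_mem' : D.br x (D.br p q) ∈ S := by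
  have hx' := hX.psi_symm_mem _ (hX.psi_symm_mem x hx)
  have hp' := hP.psi_symm_mem p hp
  have hq' := hP.phi_symm_mem q hq
  have h := D.jacobi k i j _ (D.psi_symm_grade (D.psi_symm_grade hxk)) _ (D.psi_symm_grade hpi)
    _ (D.phi_symm_grade hqj)
  simp only [LinearEquiv.apply_symm_apply] at h
  rw [add_assoc] at h
  rw [← neg_one_pow_smul_mem_iff (K := K), eq_neg_of_add_eq_zero_left h]
  refine S.neg_mem (S.add_mem (S.smul_mem _ ?_) (S.smul_mem _ ?_))
  · exact (hPT _ (hP.psi_mem p hp)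
      (hPX _ (hP.psi_mem _ hq') (hX.phi_mem _ hx')).1.1).1.1
  · exact (hPT _ (hP.psi_mem _ (hP.psi_mem _ hq'))
      (hPX _ (hP.phi_mem _ hp') (hX.psi_symm_mem x hx)).1.2).1.1

include hpi hqj hxk in
lemma br_br_mem : D.br (D.br p q) x ∈ S := by
  have h := D.br_comm_mem (S := S) (D.psi_symm_grade (D.br_grade i j p hpi q hqj))
    (D.phi_symm_grade hxk)
  simp only [LinearEquiv.apply_symm_apply] at h
  refine h ?_
  rw [D.psi_symm_br, D.phi_br]
  exact br_br_mem' hP hX hPX hPT (hP.phi_mem _ (hP.psi_symm_mem p hp))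
    (hP.phi_mem _ (hP.psi_symm_mem q hq)) (hX.psi_mem _ (hX.phi_symm_mem x hx))
    (D.phi_mem_grade (D.psi_symm_grade hpi)) (D.phi_mem_grade (D.psi_symm_grade hqj))
    (D.psi_mem_grade (D.phi_symm_grade hxk))

include hpi hqj hxk in
lemma br_mu_mem' : D.br x (D.mu p q) ∈ S := by
  have h := D.br_comm_mem (S := S) (D.psi_symm_grade hxk)
    (D.phi_symm_grade (D.mu_grade i j p hpi q hqj))
  simp only [LinearEquiv.apply_symm_apply] at h
  refine h ?_
  rw [D.phi_symm_mu, D.psi_mu]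
  exact br_mu_mem hP hX hPX hPT (hP.psi_mem _ (hP.phi_symm_mem p hp))
    (hP.psi_mem _ (hP.phi_symm_mem q hq)) (hX.phi_mem _ (hX.psi_symm_mem x hx))
    (D.psi_mem_grade (D.phi_symm_grade hqj)) (D.phi_mem_grade (D.psi_symm_grade hxk))

end Homogeneous

lemma ProductsIn.sq_left {P X T S : Submodule K A} (hP : D.IsStable P) (hX : D.IsStable X)
    (hPX : D.ProductsIn P X T) (hPT : D.ProductsIn P T S) : D.ProductsIn (D.sq P) X S := by
  intro w hw
  refine le_of_homogeneous hX.graded fun k x hx hxk => mem_transporter_comm.1 ?_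
  revert w
  refine sq_le ?_ ?_
  · refine bilin_mem_of_homogeneous _ hP.graded hP.graded fun i j p hp hpi q hq hqj => ?_
    exact ⟨⟨br_br_mem' hP hX hPX hPT hp hq hx hpi hqj hxk,
      br_br_mem hP hX hPX hPT hp hq hx hpi hqj hxk⟩,
      mu_br_mem' hP hX hPX hPT hp hq hx hpi hqj, mu_br_mem hP hX hPX hPT hp hq hx hqj hxk⟩
  · refine bilin_mem_of_homogeneous _ hP.graded hP.graded fun i j p hp hpi q hq hqj => ?_
    exact ⟨⟨br_mu_mem' hP hX hPX hPT hp hq hx hpi hqj hxk,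
      br_mu_mem hP hX hPX hPT hp hq hx hqj hxk⟩,
      mu_mu_mem' hP hX hPX hPT hp hq hx, mu_mu_mem hP hX hPX hPT hp hq hx⟩

/-- If all products between `P` and `Q` vanish, so do those between the subspaces
`P + [P, P] + P·P` and `Q + [Q, Q] + Q·Q`. -/
lemma ProductsIn.sup_sq {P Q : Submodule K A} (hP : D.IsStable P) (hQ : D.IsStable Q)
    (h : D.ProductsIn P Q ⊥) : D.ProductsIn (P ⊔ D.sq P) (Q ⊔ D.sq Q) ⊥ := by
  have h' : D.ProductsIn (P ⊔ D.sq P) Q ⊥ := h.sup_left (h.sq_left hP hQ (productsIn_bot P))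
  exact h'.sup_right (h'.symm.sq_left hQ (hP.sup hP.sq) (productsIn_bot Q)).symm

/-! ### Products of root spaces -/

variable (D)

lemma rootSpace_graded (α : Module.Dual K ↥D.H0) :
    D.rootSpace α ≤ (D.rootSpace α ⊓ D.grade 0) ⊔ (D.rootSpace α ⊓ D.grade 1) := by
  intro v hv
  obtain ⟨a, ha, b, hb, rfl⟩ := Submodule.mem_sup.1 (D.grade_sup ▸ Submodule.mem_top : v ∈ _)
  have key : ∀ h : ↥D.H0, D.br (h : A) (D.phi a) - α h • D.phi (D.psi a) = 0 ∧
      D.br (h : A) (D.phi b) - α h • D.phi (D.psi b) = 0 := by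
    intro h
    have hg : ∀ i, ∀ c ∈ D.grade i,
        D.br (h : A) (D.phi c) - α h • D.phi (D.psi c) ∈ D.grade i := by
      intro i c hc
      refine Submodule.sub_mem _ ?_
        (Submodule.smul_mem _ _ (D.phi_mem_grade (D.psi_mem_grade hc)))
      simpa using D.br_grade 0 i h h.2.2 _ (D.phi_mem_grade hc)
    have hsum : (D.br (h : A) (D.phi a) - α h • D.phi (D.psi a)) +
        (D.br (h : A) (D.phi b) - α h • D.phi (D.psi b)) = 0 := by
      have := hv h
      simp only [map_add, smul_add] at this
      rw [sub_add_sub_comm, this, sub_self]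
    have h0 : D.br (h : A) (D.phi a) - α h • D.phi (D.psi a) = 0 := by
      refine Submodule.disjoint_def.1 D.grade_disjoint _ (hg 0 a ha) ?_
      rw [eq_neg_of_add_eq_zero_left hsum]
      exact Submodule.neg_mem _ (hg 1 b hb)
    exact ⟨h0, by rwa [h0, zero_add] at hsum⟩
  exact Submodule.add_mem_sup ⟨fun h => sub_eq_zero.1 (key h).1, ha⟩
    ⟨fun h => sub_eq_zero.1 (key h).2, hb⟩

lemma skew_even {h : A} (hh : h ∈ D.grade 0) {x : A} {i : ZMod 2} (hx : x ∈ D.grade i) :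
    D.br (D.psi x) (D.phi h) = -D.br (D.psi h) (D.phi x) := by
  have := D.skew i 0 x hx h hh
  simpa using this

lemma br_mem_rootSpace {α β : Module.Dual K ↥D.H0} :
    ∀ x ∈ D.rootSpace α, ∀ y ∈ D.rootSpace β,
      D.br x y ∈ D.rootSpace (D.twist (-1) 0 α + D.twist 0 (-1) β) := by
  refine bilin_mem_of_homogeneous _ (D.rootSpace_graded α) (D.rootSpace_graded β) ?_
  intro j k x hx hxj y hy hyk
  rw [mem_rootSpace, D.psiH0.surjective.forall, D.psiH0.surjective.forall]
  intro h
  have h2 : D.br (D.psi h) (D.phi y) = β (D.psiH0 h) • D.phi (D.psi y) := hy (D.psiH0 h)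
  have h3 : D.br (D.psi h) (D.phi (D.psi.symm (D.phi x))) =
      D.twist (-1) 1 α (D.psiH0 h) • D.phi (D.psi (D.psi.symm (D.phi x))) := by
    have hx' := D.psi_symm_mem_rootSpace (D.phi_mem_rootSpace.2 hx)
    have e : D.twist 0 1 (D.twist (-1) 0 α) = D.twist (-1) 1 α := by simp
    rw [e] at hx'
    exact hx' (D.psiH0 h)
  have hα : D.twist (-1) 1 α (D.psiH0 h) = D.twist (-1) 0 α (D.psiH0 (D.psiH0 h)) := by
    rw [← D.twist_psiH0 (D.twist (-1) 1 α) (D.psiH0 h)]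
    simp
  have hj := D.jacobi 0 j k h h.2.2 _ (D.psi_symm_grade (D.phi_mem_grade hxj)) y hyk
  have hs := D.skew k j _ (D.psi_mem_grade hyk) _ (D.phi_mem_grade hxj)
  rw [D.skew_even h.2.2 hyk, h2, h3, hα] at hj
  simp only [LinearEquiv.apply_symm_apply, ZMod.val_zero, zero_mul, pow_zero, one_smul,
    map_smul, map_neg] at hj
  rw [hs, mul_comm k.val] at hj
  change D.br (D.psi (D.psi h)) _ = _
  rw [LinearMap.add_apply, D.twist_psiH0, D.phi_br, D.psi_br, D.phi_br, D.phi_psi_comm x]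
  have hsign : ((-1 : K) ^ (j.val * k.val)) * ((-1 : K) ^ (j.val * k.val)) = 1 := by
    rw [← mul_pow]
    simp
  have hterm : ∀ (c : K) (w : A), ((-1 : K) ^ (j.val * k.val)) •
      (c • (-((-1 : K) ^ (j.val * k.val)) • w)) = -(c • w) := by
    intro c w
    rw [smul_smul, smul_smul, ← neg_smul]
    congr 1
    linear_combination (-c) * hsign
  rw [hterm, D.phi_psi_comm y] at hj
  rw [add_smul, D.phi_psi_comm y]
  rw [add_assoc, add_eq_zero_iff_eq_neg] at hj
  rw [hj]
  abel

lemma mu_mem_rootSpace {α β : Module.Dual K ↥D.H0} :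
    ∀ x ∈ D.rootSpace α, ∀ y ∈ D.rootSpace β,
      D.mu x y ∈ D.rootSpace (D.twist (-1) 0 α + D.twist 0 (-1) β) := by
  refine bilin_mem_of_homogeneous _ (D.rootSpace_graded α) (D.rootSpace_graded β) ?_
  intro i j x hx hxi y hy hyj
  rw [mem_rootSpace, D.psiH0.surjective.forall, D.psiH0.surjective.forall,
    D.phiH0.surjective.forall]
  intro h
  have hαh : D.twist (-1) 0 α (D.psiH0 (D.psiH0 (D.phiH0 h))) = α (D.psiH0 (D.psiH0 h)) := by
    have : D.psiH0 (D.psiH0 (D.phiH0 h)) = D.phiH0 (D.psiH0 (D.psiH0 h)) := by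
      refine Subtype.ext ?_
      change D.psi (D.psi (D.phi h)) = D.phi (D.psi (D.psi h))
      rw [D.phi_psi_comm, D.phi_psi_comm]
    rw [this, twist_phiH0]
  rw [LinearMap.add_apply, D.twist_psiH0, hαh]
  change D.br (D.psi (D.psi (D.phi h))) _ = _
  have hh : (h : A) ∈ D.grade 0 := h.2.2
  have e1 := D.skew_even (D.psi_mem_grade (D.phi_mem_grade hh)) (D.mu_grade i j x hxi y hyj)
  have e2 := D.leibniz j 0 (D.psi x) (D.psi y) (D.psi_mem_grade hyj) (D.phi h)
    (D.phi_mem_grade hh)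
  have e3 := D.skew_even (D.phi_mem_grade hh) hyj
  have hy' : D.br (D.psi (D.phi h)) (D.phi y) = β (D.psiH0 (D.phiH0 h)) • D.phi (D.psi y) :=
    hy (D.psiH0 (D.phiH0 h))
  have hx' : D.br (D.psi (D.psi h)) (D.phi x) = α (D.psiH0 (D.psiH0 h)) • D.phi (D.psi x) :=
    hx (D.psiH0 (D.psiH0 h))
  have e5 : D.br (D.psi x) (D.psi (D.phi h)) = -D.br (D.psi (D.psi h)) (D.phi x) := by
    rw [← D.phi_psi_comm]
    exact D.skew_even (D.psi_mem_grade hh) hxi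
  rw [e3, hy', e5, hx'] at e2
  simp only [ZMod.val_zero, mul_zero, pow_zero, one_smul, map_neg, map_smul, LinearMap.neg_apply,
    LinearMap.smul_apply] at e2
  rw [D.psi_mu] at e1
  rw [eq_neg_iff_add_eq_zero, add_comm, ← eq_neg_iff_add_eq_zero] at e1
  rw [e1, e2, D.psi_mu, D.phi_mu, add_smul]
  abel

lemma H_le_rootSpace_zero : D.H ≤ D.rootSpace 0 := by
  intro x hx h
  rw [D.H_abelian _ h.2.1 _ (D.isStable_H.phi_mem x hx)]
  simp

variable {D}

lemma IsSplit.rootSpace_zero_le (hsplit : D.IsSplit) : D.rootSpace 0 ≤ D.H := by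
  let := Classical.decEq (Option ↥D.roots)
  unfold IsSplit at hsplit
  set N : Option ↥D.roots → Submodule K A := fun o => o.elim D.H fun α => D.rootSpace α.1
  intro v hv
  obtain ⟨f, rfl⟩ := hsplit.surjective v
  let c (h : ↥D.H0) (o : Option ↥D.roots) : K := o.elim 0 fun α => α.1 h
  let L (h : ↥D.H0) : DirectSum _ (fun o => N o) →ₗ[K] DirectSum _ (fun o => N o) :=
    DFinsupp.mapRange.linearMap fun o => c h o • LinearMap.id
  have hL : ∀ h (f : DirectSum _ fun o => N o),
      D.phi (D.psi (DirectSum.coeAddMonoidHom N (L h f))) =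
        D.br h (D.phi (DirectSum.coeAddMonoidHom N f)) := by
    intro h f
    induction f using DirectSum.induction_on with
    | zero => simp
    | of o x =>
      have : L h (DirectSum.of (fun o => N o) o x) =
          DirectSum.of (fun o => N o) o (c h o • x) := by
        change DFinsupp.mapRange (fun o (y : N o) => c h o • y) (fun _ => smul_zero _)
          (DFinsupp.single (β := fun o => N o) o x) =
          DFinsupp.single o _
        rw [DFinsupp.mapRange_single]
      rw [this, DirectSum.coeAddMonoidHom_of, DirectSum.coeAddMonoidHom_of]
      rcases o with _ | α
      · have := D.H_abelian _ h.2.1 _ (D.isStable_H.phi_mem x x.2)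
        simp [c, this]
      · have := x.2 h
        simp [c, this]
    | add f g hf hg => simp only [map_add, hf, hg]
  have hLf : ∀ h, L h f = 0 := by
    intro h
    apply hsplit.injective
    apply D.psi.injective
    apply D.phi.injective
    rw [hL, hv h]
    simp
  have hsome : ∀ α : ↥D.roots, f (some α) = 0 := by
    intro α
    by_contra hne
    refine α.2.1 (LinearMap.ext fun h => ?_)
    have := DFunLike.congr_fun (hLf h) (some α)
    have h2 : α.1 h • f (some α) = 0 := this
    exact (smul_eq_zero.1 h2).resolve_right hne
  have hf : f = DirectSum.of (fun o => N o) none (f none) := by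
    ext o
    rcases o with _ | α
    · simp
    · rw [hsome, DirectSum.of_eq_of_ne _ _ _ (by simp)]
  rw [hf, DirectSum.coeAddMonoidHom_of]
  exact (f none).2

lemma IsSplit.top_le (hsplit : D.IsSplit) : ⊤ ≤ D.H ⊔ ⨆ γ ∈ D.roots, D.rootSpace γ := by
  let := Classical.decEq (Option ↥D.roots)
  unfold IsSplit at hsplit
  rw [← hsplit.submodule_iSup_eq_top]
  refine iSup_le fun o => ?_
  rcases o with _ | α
  · exact le_sup_left
  · exact le_trans (le_iSup₂_of_le α.1 α.2 le_rfl) le_sup_right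

/-! ### Connectedness as an equivalence relation -/

variable (D)

lemma rootSpace_twist_ne_bot {γ : Module.Dual K ↥D.H0} (hγ : D.rootSpace γ ≠ ⊥) (a b : ℤ) :
    D.rootSpace (D.twist a b γ) ≠ ⊥ := by
  have hphi : ∀ n : ℕ, ∀ δ, D.rootSpace δ ≠ ⊥ →
      D.rootSpace (D.twist n 0 δ) ≠ ⊥ ∧ D.rootSpace (D.twist (-n) 0 δ) ≠ ⊥ := by
    intro n δ hδ
    induction n with
    | zero => simpa using hδ
    | succ n ih =>
      obtain ⟨⟨x, hx, hx0⟩, ⟨y, hy, hy0⟩⟩ :=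
        (Submodule.ne_bot_iff _).1 ih.1, (Submodule.ne_bot_iff _).1 ih.2
      refine ⟨(Submodule.ne_bot_iff _).2 ⟨_, ?_, D.phi.symm.map_ne_zero_iff.2 hx0⟩,
        (Submodule.ne_bot_iff _).2 ⟨_, ?_, D.phi.map_ne_zero_iff.2 hy0⟩⟩
      · simpa using D.phi_symm_mem_rootSpace hx
      · simpa [add_comm] using D.phi_mem_rootSpace.2 hy
  have hpsi : ∀ n : ℕ, ∀ δ, D.rootSpace δ ≠ ⊥ →
      D.rootSpace (D.twist 0 n δ) ≠ ⊥ ∧ D.rootSpace (D.twist 0 (-n) δ) ≠ ⊥ := by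
    intro n δ hδ
    induction n with
    | zero => simpa using hδ
    | succ n ih =>
      obtain ⟨⟨x, hx, hx0⟩, ⟨y, hy, hy0⟩⟩ :=
        (Submodule.ne_bot_iff _).1 ih.1, (Submodule.ne_bot_iff _).1 ih.2
      refine ⟨(Submodule.ne_bot_iff _).2 ⟨_, ?_, D.psi.symm.map_ne_zero_iff.2 hx0⟩,
        (Submodule.ne_bot_iff _).2 ⟨_, ?_, D.psi.map_ne_zero_iff.2 hy0⟩⟩
      · simpa using D.psi_symm_mem_rootSpace hx
      · simpa [add_comm] using D.psi_mem_rootSpace.2 hy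
  have h1 : D.rootSpace (D.twist a 0 γ) ≠ ⊥ := by
    rcases a.eq_nat_or_neg with ⟨n, rfl | rfl⟩
    · exact (hphi n γ hγ).1
    · exact (hphi n γ hγ).2
  have h2 : D.twist a b γ = D.twist 0 b (D.twist a 0 γ) := by simp
  rw [h2]
  rcases b.eq_nat_or_neg with ⟨n, rfl | rfl⟩
  · exact (hpsi n _ h1).1
  · exact (hpsi n _ h1).2

variable {D}

lemma twist_mem_roots {γ : Module.Dual K ↥D.H0} (hγ : γ ∈ D.roots) (a b : ℤ) :
    D.twist a b γ ∈ D.roots := by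
  refine ⟨fun h => hγ.1 ?_, D.rootSpace_twist_ne_bot hγ.2 a b⟩
  rw [D.eq_twist_neg_iff.1 h.symm |>.symm]
  simp

lemma mem_pm {S : Set (Module.Dual K ↥D.H0)} {γ : Module.Dual K ↥D.H0} :
    γ ∈ D.pm S ↔ γ ∈ S ∨ -γ ∈ S := by
  simp [pm]

lemma mem_pm_of_mem {γ : Module.Dual K ↥D.H0} (hγ : γ ∈ D.roots) : γ ∈ D.pm D.roots :=
  Or.inl hγ

lemma neg_mem_pm {γ : Module.Dual K ↥D.H0} (hγ : γ ∈ D.pm D.roots) : -γ ∈ D.pm D.roots := by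
  rw [mem_pm] at hγ ⊢
  rw [neg_neg]
  exact hγ.symm

lemma twist_mem_pm {γ : Module.Dual K ↥D.H0} (hγ : γ ∈ D.pm D.roots) (a b : ℤ) :
    D.twist a b γ ∈ D.pm D.roots := by
  rw [mem_pm] at hγ ⊢
  rw [← twist_neg]
  exact hγ.imp (twist_mem_roots · a b) (twist_mem_roots · a b)

variable (D)

/-- An elementary move between elements of `±Λ`: a twist, a change of sign, or the passage from
`δ` to `δ∘φ⁻¹ + η∘ψ⁻¹`. -/
inductive Step : Module.Dual K ↥D.H0 → Module.Dual K ↥D.H0 → Prop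
  | twist (δ) (a b : ℤ) : Step δ (D.twist a b δ)
  | neg (δ) : Step δ (-δ)
  | add {δ η} (hδ : δ ∈ D.pm D.roots) (hη : η ∈ D.pm D.roots)
      (h : D.twist (-1) 0 δ + D.twist 0 (-1) η ∈ D.pm D.roots) :
      Step δ (D.twist (-1) 0 δ + D.twist 0 (-1) η)

/-- The reflexive transitive closure of elementary moves. -/
def Linked : Module.Dual K ↥D.H0 → Module.Dual K ↥D.H0 → Prop := Relation.ReflTransGen D.Step

variable {D}

lemma linked_twist (δ : Module.Dual K ↥D.H0) (a b : ℤ) : D.Linked δ (D.twist a b δ) :=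
  .single (.twist δ a b)

lemma linked_neg (δ : Module.Dual K ↥D.H0) : D.Linked δ (-δ) := .single (.neg δ)

lemma twist_linked (δ : Module.Dual K ↥D.H0) (a b : ℤ) : D.Linked (D.twist a b δ) δ := by
  simpa using linked_twist (D.twist a b δ) (-a) (-b)

lemma Linked.trans {α β γ : Module.Dual K ↥D.H0} (h : D.Linked α β) (h' : D.Linked β γ) :
    D.Linked α γ := Relation.ReflTransGen.trans h h'

lemma Step.linked_symm {α β : Module.Dual K ↥D.H0} (h : D.Step α β) : D.Linked β α := by
  cases h with
  | twist a b => exact twist_linked α a b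
  | neg => simpa using linked_neg (-α)
  | @add η hδ hη h =>
    have e : D.twist (-1) 0 (D.twist (-1) 0 α + D.twist 0 (-1) η) +
        D.twist 0 (-1) (-D.twist (-1) 0 η) = D.twist (-2) 0 α := by
      simp
    have h1 : D.Linked (D.twist (-1) 0 α + D.twist 0 (-1) η) (D.twist (-2) 0 α) := by
      rw [← e]
      refine .single (.add h (neg_mem_pm (twist_mem_pm hη _ _)) ?_)
      rw [e]
      exact twist_mem_pm hδ _ _
    exact h1.trans (twist_linked α _ _)

lemma Linked.symm {α β : Module.Dual K ↥D.H0} (h : D.Linked α β) : D.Linked β α := by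
  induction h with
  | refl => exact .refl
  | tail _ h ih => exact h.linked_symm.trans ih

lemma chainSum_zero (a : ℕ → Module.Dual K ↥D.H0) : D.chainSum a 0 = a 1 := by
  simp [chainSum]

lemma chainSum_succ (a : ℕ → Module.Dual K ↥D.H0) (i : ℕ) :
    D.chainSum a (i + 1) = D.twist (-1) 0 (D.chainSum a i) + D.twist 0 (-1) (a (i + 2)) := by
  have hsum : ∀ s : Finset ℕ, ∀ f : ℕ → Module.Dual K ↥D.H0,
      D.twist (-1) 0 (∑ t ∈ s, f t) = ∑ t ∈ s, D.twist (-1) 0 (f t) := by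
    intro s f
    induction s using Finset.cons_induction with
    | empty => simp
    | cons _ _ _ ih => rw [Finset.sum_cons, Finset.sum_cons, twist_add, ih]
  unfold chainSum
  rw [Finset.sum_Icc_succ_top (by omega), twist_add, hsum, ← add_assoc]
  congr 1
  · congr 1
    · simp only [twist_twist]
      congr 1
      push_cast
      ring
    · refine Finset.sum_congr rfl fun t _ => ?_
      simp only [twist_twist]
      congr 1
      push_cast
      ring
  · congr 1
    push_cast
    ring

lemma chainSum_congr {a b : ℕ → Module.Dual K ↥D.H0} {i : ℕ}
    (h : ∀ t, 1 ≤ t → t ≤ i + 1 → a t = b t) : D.chainSum a i = D.chainSum b i := by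
  induction i with
  | zero => simpa [chainSum_zero] using h 1 le_rfl le_rfl
  | succ i ih =>
    rw [chainSum_succ, chainSum_succ, ih fun t h1 h2 => h t h1 (by omega),
      h (i + 2) (by omega) le_rfl]

lemma chainSum_twist (a : ℕ → Module.Dual K ↥D.H0) (m n : ℤ) (i : ℕ) :
    D.chainSum (fun t => D.twist m n (a t)) i = D.twist m n (D.chainSum a i) := by
  induction i with
  | zero => simp [chainSum_zero]
  | succ i ih =>
    rw [chainSum_succ, chainSum_succ, ih]
    simp [add_comm]

lemma neg_one_smul_dual (γ : Module.Dual K ↥D.H0) : (-1 : K) • γ = -γ := by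
  ext h
  simp

variable (D) in
/-- There is a chain `a 1, …, a (i + 1)` as in `IsConnectionIn`, possibly of length one, from `α`
to `δ`. -/
def HasChain (α δ : Module.Dual K ↥D.H0) : Prop :=
  ∃ (i : ℕ) (a : ℕ → Module.Dual K ↥D.H0),
    (∀ t, 1 ≤ t → t ≤ i + 1 → a t ∈ D.pm D.roots) ∧
    (∃ n r : ℕ, a 1 = D.twist (-(n : ℤ)) (-(r : ℤ)) α) ∧
    (∀ j, 1 ≤ j → j < i → D.chainSum a j ∈ D.pm D.roots) ∧
    (∃ m s : ℕ, D.chainSum a i = D.twist (-(m : ℤ)) (-(s : ℤ)) δ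
        ∨ D.chainSum a i = -(D.twist (-(m : ℤ)) (-(s : ℤ)) δ))

lemma HasChain.connected {α δ : Module.Dual K ↥D.H0} (h : D.HasChain α δ) :
    D.Connected α δ := by
  obtain ⟨i, a, ha, ⟨n, r, h1⟩, hj, m, s, hend⟩ := h
  rcases i with _ | i
  · left
    rw [chainSum_zero, h1] at hend
    rcases hend with h | h
    · refine ⟨-n + m, -r + s, 1, Or.inl rfl, ?_⟩
      rw [one_smul, ← (D.eq_twist_neg_iff.1 h)]
      simp
    · refine ⟨-n + m, -r + s, -1, Or.inr rfl, ?_⟩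
      rw [← twist_neg] at h
      have := D.eq_twist_neg_iff.1 h
      rw [neg_one_smul_dual, ← neg_eq_iff_eq_neg, ← this]
      simp
  · exact Or.inr ⟨i + 2, a, by omega, ha, ⟨n, r, h1⟩, fun j h1 h2 => hj j h1 (by omega), m, s, hend⟩

lemma HasChain.twist {α δ : Module.Dual K ↥D.H0} (h : D.HasChain α δ) (z w : ℤ) :
    D.HasChain α (D.twist z w δ) := by
  obtain ⟨i, a, ha, ⟨n, r, h1⟩, hj, m, s, hend⟩ := h
  refine ⟨i, fun t => D.twist (-(z.natAbs : ℤ)) (-(w.natAbs : ℤ)) (a t),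
    fun t h1 h2 => twist_mem_pm (ha t h1 h2) _ _, ⟨n + z.natAbs, r + w.natAbs, ?_⟩,
    fun j h1 h2 => ?_, (m + z.natAbs + z).toNat, (s + w.natAbs + w).toNat, ?_⟩
  · simp only [h1, twist_twist]
    congr 1 <;> push_cast <;> ring
  · rw [chainSum_twist]
    exact twist_mem_pm (hj j h1 h2) _ _
  · rw [chainSum_twist, Int.toNat_of_nonneg (by omega), Int.toNat_of_nonneg (by omega)]
    have e : D.twist (-(z.natAbs : ℤ)) (-(w.natAbs : ℤ)) (D.twist (-(m : ℤ)) (-(s : ℤ)) δ) =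
        D.twist (-(m + z.natAbs + z)) (-(s + w.natAbs + w)) (D.twist z w δ) := by
      simp only [twist_twist]
      congr 1 <;> ring
    rcases hend with h | h
    · left
      rw [h, e]
    · right
      rw [h, twist_neg, e]

lemma HasChain.neg {α δ : Module.Dual K ↥D.H0} (h : D.HasChain α δ) : D.HasChain α (-δ) := by
  obtain ⟨i, a, ha, h1, hj, m, s, hend⟩ := h
  refine ⟨i, a, ha, h1, hj, m, s, ?_⟩
  rw [twist_neg, neg_neg]
  exact hend.symm

lemma HasChain.add {α δ η : Module.Dual K ↥D.H0} (h : D.HasChain α δ)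
    (hδ : δ ∈ D.pm D.roots) (hη : η ∈ D.pm D.roots) :
    D.HasChain α (D.twist (-1) 0 δ + D.twist 0 (-1) η) := by
  obtain ⟨i, a, ha, ⟨n, r, h1⟩, hj, m, s, hend⟩ := h
  have extend : ∀ η' ∈ D.pm D.roots, ∀ (δ' : Module.Dual K ↥D.H0),
      (D.twist (-1) 0 (D.chainSum a i) + D.twist 0 (-1) η' = D.twist (-(m : ℤ)) (-(s : ℤ)) δ' ∨
        D.twist (-1) 0 (D.chainSum a i) + D.twist 0 (-1) η' =
          -D.twist (-(m : ℤ)) (-(s : ℤ)) δ') → D.HasChain α δ' := by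
    intro η' hη' δ' hend'
    have hcongr : ∀ j ≤ i, D.chainSum (Function.update a (i + 2) η') j = D.chainSum a j :=
      fun j hji => chainSum_congr fun t _ h2 => Function.update_of_ne (by omega) _ _
    refine ⟨i + 1, Function.update a (i + 2) η', fun t h1 h2 => ?_, ⟨n, r, ?_⟩,
      fun j h1 h2 => ?_, m, s, ?_⟩
    · rcases eq_or_ne t (i + 2) with rfl | ht
      · simpa using hη'
      · rw [Function.update_of_ne ht]
        exact ha t h1 (by omega)
    · rw [Function.update_of_ne (by omega), h1]
    · rw [hcongr j (by omega)]
      rcases (Nat.lt_succ_iff.1 h2).lt_or_eq with h | rfl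
      · exact hj j h1 h
      · rcases hend with h | h <;> rw [h]
        · exact twist_mem_pm hδ _ _
        · exact neg_mem_pm (twist_mem_pm hδ _ _)
    · rw [chainSum_succ, hcongr i le_rfl, Function.update_self]
      exact hend'
  rcases hend with h | h
  · refine extend (D.twist (-(m : ℤ)) (-(s : ℤ)) η) (twist_mem_pm hη _ _) _ (Or.inl ?_)
    rw [h]
    simp [add_comm]
  · refine extend (-D.twist (-(m : ℤ)) (-(s : ℤ)) η) (neg_mem_pm (twist_mem_pm hη _ _)) _
      (Or.inr ?_)
    rw [h]
    simp [add_comm]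

lemma Linked.hasChain {α δ : Module.Dual K ↥D.H0} (hα : α ∈ D.roots) (h : D.Linked α δ) :
    D.HasChain α δ := by
  induction h with
  | refl =>
    exact ⟨0, fun _ => α, fun _ _ _ => mem_pm_of_mem hα, ⟨0, 0, by simp⟩,
      fun j h1 h2 => by omega, 0, 0, by simp [chainSum_zero]⟩
  | tail _ h ih =>
    cases h with
    | twist a b => exact ih.twist a b
    | neg => exact ih.neg
    | add hδ hη _ => exact ih.add hδ hη

lemma Connected.linked {α β : Module.Dual K ↥D.H0} (hβ : β ∈ D.roots)
    (h : D.Connected α β) : D.Linked α β := by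
  rcases h with ⟨z, w, ε, rfl | rfl, rfl⟩ | ⟨k, a, hk, ha, ⟨n, r, h1⟩, hj, m, s, hend⟩
  · rw [one_smul]
    exact linked_twist _ _ _
  · rw [neg_one_smul_dual]
    exact (linked_twist _ _ _).trans (linked_neg _)
  · have hpm : ∀ j ≤ k - 1, D.chainSum a j ∈ D.pm D.roots := by
      intro j hjk
      rcases Nat.eq_zero_or_pos j with rfl | hj0
      · rw [chainSum_zero]
        exact ha 1 le_rfl (by omega)
      rcases hjk.lt_or_eq with h | rfl
      · exact hj j hj0 (by omega)
      · rcases hend with h | h <;> rw [h]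
        · exact twist_mem_pm (mem_pm_of_mem hβ) _ _
        · exact neg_mem_pm (twist_mem_pm (mem_pm_of_mem hβ) _ _)
    have hl : ∀ j ≤ k - 1, D.Linked α (D.chainSum a j) := by
      intro j hjk
      induction j with
      | zero =>
        rw [chainSum_zero, h1]
        exact linked_twist _ _ _
      | succ j ih =>
        refine (ih (by omega)).trans (.single ?_)
        have := hpm (j + 1) hjk
        rw [chainSum_succ] at this ⊢
        exact .add (hpm j (by omega)) (ha (j + 2) (by omega) (by omega)) this
    have hlast := hl (k - 1) le_rfl
    rcases hend with h | h <;> rw [h] at hlast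
    · exact hlast.trans (twist_linked _ _ _)
    · refine hlast.trans (Linked.trans ?_ (twist_linked β (-(m : ℤ)) (-(s : ℤ))))
      simpa using linked_neg (-D.twist (-(m : ℤ)) (-(s : ℤ)) β)

lemma mem_classSet {α β : Module.Dual K ↥D.H0} (hα : α ∈ D.roots) :
    β ∈ D.classSet α ↔ β ∈ D.roots ∧ D.Linked α β :=
  and_congr_right fun hβ => ⟨fun h => h.linked hβ, fun h => (h.hasChain hα).connected⟩

lemma self_mem_classSet {α : Module.Dual K ↥D.H0} (hα : α ∈ D.roots) : α ∈ D.classSet α :=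
  (mem_classSet hα).2 ⟨hα, .refl⟩

lemma twist_mem_classSet {α β : Module.Dual K ↥D.H0} (hα : α ∈ D.roots)
    (hβ : β ∈ D.classSet α) (a b : ℤ) : D.twist a b β ∈ D.classSet α := by
  rw [mem_classSet hα] at hβ ⊢
  exact ⟨twist_mem_roots hβ.1 a b, hβ.2.trans (linked_twist _ _ _)⟩

lemma Linked.classSet_eq {α β : Module.Dual K ↥D.H0} (hα : α ∈ D.roots) (hβ : β ∈ D.roots)
    (h : D.Linked α β) : D.classSet α = D.classSet β := by
  ext γ
  rw [mem_classSet hα, mem_classSet hβ]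
  exact and_congr_right fun _ => ⟨h.symm.trans, h.trans⟩

/-! ### The subspaces attached to a class of roots -/

lemma rootSpace_le_VS {α β : Module.Dual K ↥D.H0} (hα : α ∈ D.roots) (h : D.Linked α β)
    (hβ : β ≠ 0) : D.rootSpace β ≤ D.VS α := by
  by_cases hb : D.rootSpace β = ⊥
  · simp [hb]
  · exact le_iSup₂_of_le β ((mem_classSet hα).2 ⟨⟨hβ, hb⟩, h⟩) le_rfl

lemma isStable_VS {α : Module.Dual K ↥D.H0} (hα : α ∈ D.roots) : D.IsStable (D.VS α) := by
  have hmem : ∀ β ∈ D.classSet α, ∀ a b, D.rootSpace (D.twist a b β) ≤ D.VS α :=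
    fun β hβ a b => le_iSup₂_of_le _ (twist_mem_classSet hα hβ a b) le_rfl
  constructor
  · refine iSup₂_le fun β hβ => le_of_homogeneous (D.rootSpace_graded β) fun i x hx hi => ?_
    have hle : D.rootSpace β ≤ D.VS α := le_iSup₂_of_le β hβ le_rfl
    exact mem_graded_of_homogeneous (hle hx) hi
  · change D.VS α ≤ (D.VS α).comap (D.phi : A →ₗ[K] A)
    exact iSup₂_le fun β hβ x hx => hmem β hβ _ _ (D.phi_mem_rootSpace.2 hx)
  · change D.VS α ≤ (D.VS α).comap (D.psi : A →ₗ[K] A)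
    exact iSup₂_le fun β hβ x hx => hmem β hβ _ _ (D.psi_mem_rootSpace.2 hx)
  · change D.VS α ≤ (D.VS α).comap (D.phi.symm : A →ₗ[K] A)
    exact iSup₂_le fun β hβ x hx => hmem β hβ _ _ (D.phi_symm_mem_rootSpace hx)
  · change D.VS α ≤ (D.VS α).comap (D.psi.symm : A →ₗ[K] A)
    exact iSup₂_le fun β hβ x hx => hmem β hβ _ _ (D.psi_symm_mem_rootSpace hx)

lemma productsIn_rootSpace {β γ : Module.Dual K ↥D.H0} {T : Submodule K A}
    (h1 : D.rootSpace (D.twist (-1) 0 β + D.twist 0 (-1) γ) ≤ T)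
    (h2 : D.rootSpace (D.twist (-1) 0 γ + D.twist 0 (-1) β) ≤ T) :
    D.ProductsIn (D.rootSpace β) (D.rootSpace γ) T :=
  fun x hx y hy => ⟨⟨h1 (D.br_mem_rootSpace x hx y hy), h2 (D.br_mem_rootSpace y hy x hx)⟩,
    h1 (D.mu_mem_rootSpace x hx y hy), h2 (D.mu_mem_rootSpace y hy x hx)⟩

lemma eq_neg_twist_of_add_eq_zero {β γ : Module.Dual K ↥D.H0}
    (h : D.twist (-1) 0 β + D.twist 0 (-1) γ = 0) : γ = -D.twist (-1) 1 β := by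
  have := D.eq_twist_neg_iff.1 (eq_neg_of_add_eq_zero_right h).symm
  rw [← this]
  simp

lemma rootSpace_add_eq_bot {β γ : Module.Dual K ↥D.H0} (hβ : β ∈ D.roots) (hγ : γ ∈ D.roots)
    (h : ¬ D.Linked β γ) : D.rootSpace (D.twist (-1) 0 β + D.twist 0 (-1) γ) = ⊥ := by
  by_contra hne
  have h0 : D.twist (-1) 0 β + D.twist 0 (-1) γ ≠ 0 := by
    intro h0
    rw [eq_neg_twist_of_add_eq_zero h0] at h
    exact h ((linked_twist _ _ _).trans (linked_neg _))
  have hroot : D.twist (-1) 0 β + D.twist 0 (-1) γ ∈ D.roots := ⟨h0, hne⟩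
  have hβδ : D.Linked β (D.twist (-1) 0 β + D.twist 0 (-1) γ) :=
    .single (.add (mem_pm_of_mem hβ) (mem_pm_of_mem hγ) (mem_pm_of_mem hroot))
  have e : D.twist (-1) 0 γ + D.twist 0 (-1) (D.twist (-2) 2 β) =
      D.twist (-1) 1 (D.twist (-1) 0 β + D.twist 0 (-1) γ) := by
    simp [add_comm]
  have hγδ : D.Linked γ (D.twist (-1) 1 (D.twist (-1) 0 β + D.twist 0 (-1) γ)) := by
    rw [← e]
    refine .single (.add (mem_pm_of_mem hγ) (twist_mem_pm (mem_pm_of_mem hβ) _ _) ?_)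
    rw [e]
    exact twist_mem_pm (mem_pm_of_mem hroot) _ _
  exact h (hβδ.trans (hγδ.trans (twist_linked _ _ _)).symm)

lemma productsIn_VS_of_not_linked {α β : Module.Dual K ↥D.H0} (hα : α ∈ D.roots)
    (hβ : β ∈ D.roots) (h : ¬ D.Linked α β) : D.ProductsIn (D.VS α) (D.VS β) ⊥ := by
  refine productsIn_iSup₂_right fun δ hδ => (productsIn_iSup₂_right fun γ hγ => ?_).symm
  rw [mem_classSet hα] at hγ
  rw [mem_classSet hβ] at hδ
  have hl : ¬ D.Linked γ δ := fun hl => h (hγ.2.trans (hl.trans hδ.2.symm))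
  exact productsIn_rootSpace (rootSpace_add_eq_bot hδ.1 hγ.1 fun h => hl h.symm).le
    (rootSpace_add_eq_bot hγ.1 hδ.1 hl).le

lemma IH_le_sq {α : Module.Dual K ↥D.H0} (hα : α ∈ D.roots) : D.IH α ≤ D.sq (D.VS α) := by
  refine iSup₂_le fun β hβ => ?_
  rw [mem_classSet hα] at hβ
  have h1 : D.rootSpace (D.twist 0 (-1) β) ≤ D.VS α :=
    rootSpace_le_VS hα (hβ.2.trans (linked_twist _ _ _)) (twist_mem_roots hβ.1 _ _).1
  have h2 : D.rootSpace (-D.twist (-1) 0 β) ≤ D.VS α :=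
    rootSpace_le_VS hα (hβ.2.trans ((linked_twist _ _ _).trans (linked_neg _)))
      (neg_ne_zero.2 (twist_mem_roots hβ.1 _ _).1)
  exact sup_le_sup (Submodule.map₂_le_map₂ h1 h2) (Submodule.map₂_le_map₂ h1 h2)

lemma mul_mem_Iclass (f : A →ₗ[K] A →ₗ[K] A)
    (hf : ∀ β γ : Module.Dual K ↥D.H0, ∀ x ∈ D.rootSpace β, ∀ y ∈ D.rootSpace γ,
      f x y ∈ D.rootSpace (D.twist (-1) 0 β + D.twist 0 (-1) γ))
    {α : Module.Dual K ↥D.H0} (hα : α ∈ D.roots)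
    (hle : ∀ β ∈ D.classSet α, Submodule.map₂ f (D.rootSpace (D.twist 0 (-1) β))
      (D.rootSpace (-D.twist (-1) 0 β)) ≤ D.IH α) :
    Submodule.map₂ f (D.VS α) (D.VS α) ≤ D.Iclass α := by
  unfold VS
  simp only [Submodule.map₂_iSup_left, Submodule.map₂_iSup_right]
  refine iSup₂_le fun γ hγ => iSup₂_le fun β hβ => ?_
  by_cases h0 : D.twist (-1) 0 β + D.twist 0 (-1) γ = 0
  · have := hle _ (twist_mem_classSet hα hβ 0 1)
    simp only [twist_twist] at this
    rw [eq_neg_twist_of_add_eq_zero h0]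
    refine le_trans ?_ (this.trans le_sup_left)
    simp
  · refine le_trans (Submodule.map₂_le.2 (hf β γ)) ?_
    by_cases hb : D.rootSpace (D.twist (-1) 0 β + D.twist 0 (-1) γ) = ⊥
    · simp [hb]
    · rw [mem_classSet hα] at hβ hγ
      refine le_trans (rootSpace_le_VS hα (hβ.2.trans (.single ?_)) h0) le_sup_right
      exact .add (mem_pm_of_mem hβ.1) (mem_pm_of_mem hγ.1) (mem_pm_of_mem ⟨h0, hb⟩)

lemma sq_VS_le_Iclass {α : Module.Dual K ↥D.H0} (hα : α ∈ D.roots) :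
    D.sq (D.VS α) ≤ D.Iclass α :=
  sup_le
    (mul_mem_Iclass D.br (fun _ _ => D.br_mem_rootSpace) hα
      fun β hβ => le_iSup₂_of_le β hβ le_sup_left)
    (mul_mem_Iclass D.mu (fun _ _ => D.mu_mem_rootSpace) hα
      fun β hβ => le_iSup₂_of_le β hβ le_sup_right)

lemma Iclass_eq {α : Module.Dual K ↥D.H0} (hα : α ∈ D.roots) :
    D.Iclass α = D.VS α ⊔ D.sq (D.VS α) :=
  le_antisymm (sup_le ((IH_le_sq hα).trans le_sup_right) le_sup_left)
    (sup_le le_sup_right (sq_VS_le_Iclass hα))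

lemma IsSplit.IH_le_H (hsplit : D.IsSplit) (α : Module.Dual K ↥D.H0) : D.IH α ≤ D.H := by
  have e : ∀ β, D.twist (-1) 0 (D.twist 0 (-1) β) + D.twist 0 (-1) (-D.twist (-1) 0 β) = 0 := by
    intro β
    simp
  refine iSup₂_le fun β _ => sup_le (Submodule.map₂_le.2 fun x hx y hy => ?_)
    (Submodule.map₂_le.2 fun x hx y hy => ?_)
  · exact hsplit.rootSpace_zero_le (e β ▸ D.br_mem_rootSpace x hx y hy)
  · exact hsplit.rootSpace_zero_le (e β ▸ D.mu_mem_rootSpace x hx y hy)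

lemma productsIn_H_VS {α : Module.Dual K ↥D.H0} (hα : α ∈ D.roots) :
    D.ProductsIn D.H (D.VS α) (D.VS α) := by
  refine productsIn_iSup₂_right fun β hβ => ?_
  refine (productsIn_rootSpace ?_ ?_).mono D.H_le_rootSpace_zero le_rfl le_rfl
  · rw [twist_zero, zero_add]
    exact le_iSup₂_of_le _ (twist_mem_classSet hα hβ 0 (-1)) le_rfl
  · rw [twist_zero, add_zero]
    exact le_iSup₂_of_le _ (twist_mem_classSet hα hβ (-1) 0) le_rfl

lemma IsSplit.productsIn_Iclass (hsplit : D.IsSplit) {α : Module.Dual K ↥D.H0}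
    (hα : α ∈ D.roots) : D.ProductsIn (D.Iclass α) ⊤ (D.Iclass α) := by
  have hP := isStable_VS hα
  have hH := productsIn_H_VS hα
  have hsq : D.sq (D.VS α) ≤ D.H ⊔ D.VS α :=
    (sq_VS_le_Iclass hα).trans (sup_le_sup_right (hsplit.IH_le_H α) _)
  rw [Iclass_eq hα]
  refine ProductsIn.mono (X := D.H ⊔ ⨆ γ ∈ D.roots, D.rootSpace γ) ?_ le_rfl hsplit.top_le le_rfl
  refine ProductsIn.sup_right ?_ (productsIn_iSup₂_right fun γ hγ => ?_)
  · refine ProductsIn.sup_left (hH.symm.mono le_rfl le_rfl le_sup_left) ?_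
    exact (hH.symm.sq_left hP D.isStable_H (productsIn_sq _)).mono le_rfl le_rfl le_sup_right
  · by_cases hl : D.Linked α γ
    · have hPP : D.ProductsIn (D.VS α) (D.VS α) (D.VS α ⊔ D.sq (D.VS α)) :=
        (productsIn_sq _).mono le_rfl le_rfl le_sup_right
      refine ProductsIn.mono (hPP.sup_left ?_) le_rfl (rootSpace_le_VS hα hl hγ.1) le_rfl
      exact ((hH.mono le_rfl le_rfl le_sup_left).sup_left hPP).mono hsq le_rfl le_rfl
    · exact ((productsIn_VS_of_not_linked hα hγ hl).sup_sq hP (isStable_VS hγ)).mono le_rfl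
        ((rootSpace_le_VS hγ .refl hγ.1).trans le_sup_left) bot_le

lemma IsSplit.isIdeal_Iclass (hsplit : D.IsSplit) {α : Module.Dual K ↥D.H0}
    (hα : α ∈ D.roots) : D.IsIdeal (D.Iclass α) := by
  have hP := isStable_VS hα
  have hI : D.IsStable (D.Iclass α) := by
    rw [Iclass_eq hα]
    exact hP.sup hP.sq
  have h := hsplit.productsIn_Iclass hα
  exact ⟨le_top, hI.graded_eq, Submodule.map₂_le.2 fun x hx y hy => (h x hx hy).1.1,
    Submodule.map₂_le.2 fun x hx y hy => (h x hx hy).2.1,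
    Submodule.map₂_le.2 fun x hx y hy => (h y hy hx).2.2, hI.map_phi, hI.map_psi⟩

end BHPS

namespace BHPS

variable {K A : Type*}

/-- `A = U + Σ_{[α]∈Λ/∼} I_{[α]}` with each `I_{[α]}` an ideal and
`[I_{[α]}, I_{[β]}] + I_{[α]}·I_{[β]} = 0` for `[α] ≠ [β]`. -/
theorem decomposition {K A : Type*} [Field K] [AddCommGroup A] [Module K A] (D : BHPS K A)
    (hsplit : D.IsSplit)
    (U : Submodule K A) (hU1 : U ⊔ D.HSum = D.H) (hU2 : U ⊓ D.HSum = ⊥) :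
    (U ⊔ ⨆ α ∈ D.roots, D.Iclass α) = ⊤ ∧
    (∀ α ∈ D.roots, D.IsIdeal (D.Iclass α)) ∧
    (∀ α ∈ D.roots, ∀ β ∈ D.roots, D.classSet α ≠ D.classSet β →
      Submodule.map₂ D.br (D.Iclass α) (D.Iclass β)
        ⊔ Submodule.map₂ D.mu (D.Iclass α) (D.Iclass β) = ⊥) := by
  refine ⟨?_, fun α hα => hsplit.isIdeal_Iclass hα, fun α hα β hβ hne => ?_⟩
  · have hclass : ∀ α ∈ D.roots, D.Iclass α ≤ U ⊔ ⨆ α ∈ D.roots, D.Iclass α :=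
      fun α hα => le_sup_of_le_right (le_iSup₂_of_le α hα le_rfl)
    refine top_le_iff.1 (hsplit.top_le.trans (sup_le ?_ (iSup₂_le fun γ hγ => ?_)))
    · rw [← hU1]
      refine sup_le le_sup_left (iSup₂_le fun α hα => le_trans ?_ (hclass α hα))
      exact le_sup_of_le_left (le_iSup₂_of_le α (self_mem_classSet hα) le_rfl)
    · exact ((rootSpace_le_VS hγ .refl hγ.1).trans le_sup_right).trans (hclass γ hγ)
  · have h := (productsIn_VS_of_not_linked hα hβ fun hl => hne (hl.classSet_eq hα hβ)).sup_sq
      (isStable_VS hα) (isStable_VS hβ)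
    rw [Iclass_eq hα, Iclass_eq hβ, eq_bot_iff]
    exact sup_le (Submodule.map₂_le.2 fun x hx y hy => (h x hx hy).1.1)
      (Submodule.map₂_le.2 fun x hx y hy => (h x hx hy).2.1)

end BHPS
end

section
/- Let A = H ⊕ (⊕_{α∈Γ} A_α) be a split Poisson superalgebra with maximal abelian graded subalgebra H and root system Γ, and let φ, ψ : A → A be two commuting even Poisson superalgebra automorphisms with φ(H) = ψ(H) = H. Then the regular BiHom-Poisson superalgebra (A, μ', [·,·]', φ, ψ) obtained by the twist [x,y]' := [φ(x), ψ(y)], μ'(x⊗y) := φ(x)ψ(y) is split with respect to H, with decomposition A = H ⊕ (⊕_{α∈Γ} A_{α∘ψ⁻¹}) and root system Λ = {α∘ψ⁻¹ : α ∈ Γ}. -/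
/-- A Poisson superalgebra over a field `K`: a ℤ₂-graded vector space with an even
supercommutative associative product `mu` and an even Lie superbracket `br`
satisfying the Leibniz superidentity. -/
structure PoissonSuper (K A : Type*) [Field K] [AddCommGroup A] [Module K A] where
  /-- the ℤ₂-grading -/
  grade : ZMod 2 → Submodule K A
  gradeInternal : DirectSum.IsInternal grade
  /-- the Lie superbracket -/
  br : A →ₗ[K] A →ₗ[K] A
  /-- the associative product -/
  mu : A →ₗ[K] A →ₗ[K] A
  br_grade : ∀ (i j : ZMod 2), ∀ x ∈ grade i, ∀ y ∈ grade j, br x y ∈ grade (i + j)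
  mu_grade : ∀ (i j : ZMod 2), ∀ x ∈ grade i, ∀ y ∈ grade j, mu x y ∈ grade (i + j)
  mu_comm : ∀ (i j : ZMod 2), ∀ x ∈ grade i, ∀ y ∈ grade j,
    mu x y = ((-1 : K) ^ (i.val * j.val)) • mu y x
  mu_assoc : ∀ x y z, mu x (mu y z) = mu (mu x y) z
  br_skew : ∀ (i j : ZMod 2), ∀ x ∈ grade i, ∀ y ∈ grade j,
    br x y = -((-1 : K) ^ (i.val * j.val)) • br y x
  br_jacobi : ∀ (i j k : ZMod 2), ∀ x ∈ grade i, ∀ y ∈ grade j, ∀ z ∈ grade k,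
    ((-1 : K) ^ (i.val * k.val)) • br x (br y z)
      + ((-1 : K) ^ (i.val * j.val)) • br y (br z x)
      + ((-1 : K) ^ (j.val * k.val)) • br z (br x y) = 0
  leibniz : ∀ (j k : ZMod 2), ∀ (x : A), ∀ y ∈ grade j, ∀ z ∈ grade k,
    br (mu x y) z = mu x (br y z) + ((-1 : K) ^ (j.val * k.val)) • mu (br x z) y

namespace PoissonSuper

variable {K A : Type*} [Field K] [AddCommGroup A] [Module K A]
variable (P : PoissonSuper K A) (H : Submodule K A)

/-- The even part `H₀` of `H`. -/
def H0 : Submodule K A := H ⊓ P.grade 0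

/-- The (Poisson) root space `A_α = {v : [h, v] = α(h) • v for all h ∈ H₀}`. -/
def rootSpace (α : Module.Dual K ↥(P.H0 H)) : Submodule K A where
  carrier := {v | ∀ h : ↥(P.H0 H), P.br (h : A) v = α h • v}
  add_mem' := by
    intro a b ha hb h
    simp only [map_add, ha h, hb h, smul_add]
  zero_mem' := by
    intro h
    simp
  smul_mem' := by
    intro c v hv h
    simp only [map_smul, hv h]
    rw [smul_comm]

/-- The (Poisson) root system `Γ`. -/
def roots : Set (Module.Dual K ↥(P.H0 H)) := {α | α ≠ 0 ∧ P.rootSpace H α ≠ ⊥}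

/-- The Poisson superalgebra is split with respect to `H`: `A = H ⊕ (⊕_{α∈Γ} A_α)`. -/
def IsSplit : Prop :=
  letI := Classical.decEq (Option ↥(P.roots H))
  DirectSum.IsInternal (fun o : Option ↥(P.roots H) => o.elim H fun α => P.rootSpace H α.1)

/-- The root space of the twisted BiHom-Poisson superalgebra attached to `β : H₀ → K`:
`A'_β = {v : [h, φ(v)]' = β(h) • φψ(v) for all h ∈ H₀}` where `[x,y]' = [φ(x), ψ(y)]`. -/
def twRootSpace (phi psi : A ≃ₗ[K] A) (β : Module.Dual K ↥(P.H0 H)) : Submodule K A where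
  carrier := {v | ∀ h : ↥(P.H0 H), P.br (phi (h : A)) (psi (phi v)) = β h • phi (psi v)}
  add_mem' := by
    intro a b ha hb h
    simp only [map_add, ha h, hb h, smul_add]
  zero_mem' := by
    intro h
    simp
  smul_mem' := by
    intro c v hv h
    simp only [map_smul, hv h]
    rw [smul_comm]

/-- The twisted root space of `β` is the untwisted root space of `β ∘ ψ`. -/
theorem twRootSpace_eq_rootSpace (phi psi : A ≃ₗ[K] A)
    (hcomm : ∀ x, phi (psi x) = psi (phi x))
    (hphibr : ∀ x y, phi (P.br x y) = P.br (phi x) (phi y))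
    (hpsibr : ∀ x y, psi (P.br x y) = P.br (psi x) (psi y))
    (psiH : ↥(P.H0 H) ≃ₗ[K] ↥(P.H0 H))
    (hpsiH0 : ∀ h : ↥(P.H0 H), (psiH h : A) = psi (h : A))
    (β : Module.Dual K ↥(P.H0 H)) :
    P.twRootSpace H phi psi β =
      P.rootSpace H (β ∘ₗ (psiH : ↥(P.H0 H) →ₗ[K] ↥(P.H0 H))) := by
  ext v
  change (∀ h : ↥(P.H0 H), P.br (phi (h : A)) (psi (phi v)) = β h • phi (psi v)) ↔
    ∀ h : ↥(P.H0 H), P.br (h : A) v = β (psiH h) • v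
  refine psiH.surjective.forall.trans (forall_congr' fun h => ?_)
  rw [hpsiH0, ← hcomm, ← hphibr, ← hpsibr, ← map_smul, ← map_smul,
    phi.injective.eq_iff, psi.injective.eq_iff]

/-- a split Poisson superalgebra `A = H ⊕ (⊕_{α∈Γ} A_α)`, twisted by two
commuting even Poisson automorphisms `φ, ψ` with `φ(H) = ψ(H) = H`, becomes a split
regular BiHom-Poisson superalgebra with decomposition `A = H ⊕ (⊕_{α∈Γ} A'_{α∘ψ⁻¹})`
and root system `Λ = {α∘ψ⁻¹ : α ∈ Γ}`. -/
theorem twist_isSplit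
    (hHgr : H = (H ⊓ P.grade 0) ⊔ (H ⊓ P.grade 1))
    (hab : ∀ x ∈ H, ∀ y ∈ H, P.br x y = 0)
    (hmax : ∀ H' : Submodule K A, H ≤ H' →
      H' = (H' ⊓ P.grade 0) ⊔ (H' ⊓ P.grade 1) →
      (∀ x ∈ H', ∀ y ∈ H', P.br x y = 0) → H' = H)
    (hsplit : P.IsSplit H)
    (phi psi : A ≃ₗ[K] A)
    (hcomm : ∀ x, phi (psi x) = psi (phi x))
    (hphig : ∀ (i : ZMod 2), ∀ x ∈ P.grade i, phi x ∈ P.grade i)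
    (hpsig : ∀ (i : ZMod 2), ∀ x ∈ P.grade i, psi x ∈ P.grade i)
    (hphibr : ∀ x y, phi (P.br x y) = P.br (phi x) (phi y))
    (hpsibr : ∀ x y, psi (P.br x y) = P.br (psi x) (psi y))
    (hphimu : ∀ x y, phi (P.mu x y) = P.mu (phi x) (phi y))
    (hpsimu : ∀ x y, psi (P.mu x y) = P.mu (psi x) (psi y))
    (hphiH : H.map (phi : A →ₗ[K] A) = H)
    (hpsiH : H.map (psi : A →ₗ[K] A) = H)
    (psiH : ↥(P.H0 H) ≃ₗ[K] ↥(P.H0 H))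
    (hpsiH0 : ∀ h : ↥(P.H0 H), (psiH h : A) = psi (h : A)) :
    ({β : Module.Dual K ↥(P.H0 H) | β ≠ 0 ∧ P.twRootSpace H phi psi β ≠ ⊥}
        = (fun α : Module.Dual K ↥(P.H0 H) =>
            α ∘ₗ (psiH.symm : ↥(P.H0 H) →ₗ[K] ↥(P.H0 H))) '' P.roots H) ∧
    (letI := Classical.decEq (Option ↥(P.roots H))
     DirectSum.IsInternal (fun o : Option ↥(P.roots H) =>
       o.elim H fun α =>
         P.twRootSpace H phi psi
           (α.1 ∘ₗ (psiH.symm : ↥(P.H0 H) →ₗ[K] ↥(P.H0 H))))) := by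
  have key := P.twRootSpace_eq_rootSpace H phi psi hcomm hphibr hpsibr psiH hpsiH0
  have cancel : ∀ α : Module.Dual K ↥(P.H0 H),
      (α ∘ₗ (psiH.symm : ↥(P.H0 H) →ₗ[K] ↥(P.H0 H))) ∘ₗ
        (psiH : ↥(P.H0 H) →ₗ[K] ↥(P.H0 H)) = α := fun α => by ext; simp
  have cancel' : ∀ β : Module.Dual K ↥(P.H0 H),
      (β ∘ₗ (psiH : ↥(P.H0 H) →ₗ[K] ↥(P.H0 H))) ∘ₗ
        (psiH.symm : ↥(P.H0 H) →ₗ[K] ↥(P.H0 H)) = β := fun β => by ext; simp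
  constructor
  · ext β
    constructor
    · rintro ⟨hβ, hne⟩
      refine ⟨_, ⟨fun h => hβ ?_, key β ▸ hne⟩, cancel' β⟩
      rw [← cancel' β, h, LinearMap.zero_comp]
    · rintro ⟨α, ⟨hα, hne⟩, rfl⟩
      refine ⟨fun h => hα ?_, ?_⟩
      · rw [← cancel α]
        exact (congrArg (· ∘ₗ (psiH : ↥(P.H0 H) →ₗ[K] ↥(P.H0 H))) h).trans
          (LinearMap.zero_comp _)
      · rwa [key, cancel]
  · simp only [key, cancel]
    exact hsplit

end PoissonSuper
end
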